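/- arXiv:1304.5729 — 3 statements merged into one kernel-verified Lean document; each statement's English description precedes it below -/
import Mathlib

section
/- Let F be a proof-irrelevant family of setoids over a setoid (I, ≈_I). Then the relation ~ on the type Σ i : I, F i, defined by (i, y) ~ (i', y') iff there exists a proof p : i ≈_I i' with F(p)(y) ≈_{F i'} y', is an equivalence relation. -/
/-- A proof-irrelevant family of setoids over a setoid `I`. -/
structure PIFam (I : Type) [Setoid I] where
  /-- the underlying type of each fiber setoid -/
  obj : I → Type
  /-- the equivalence relation of each fiber setoid -/
  std : ∀ i, Setoid (obj i)
  /-- transport along a proof `p : i ≈ j` -/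
  map : ∀ {i j : I}, i ≈ j → obj i → obj j
  /-- transports are extensional -/
  map_ext : ∀ {i j : I} (p : i ≈ j) {x x' : obj i},
    (std i).r x x' → (std j).r (map p x) (map p x')
  /-- (F1) transport along reflexivity is the identity -/
  map_refl : ∀ (i : I) (x : obj i), (std i).r (map (Setoid.refl i) x) x
  /-- (F2) proof irrelevance of transport -/
  map_irrel : ∀ {i j : I} (p q : i ≈ j) (x : obj i), (std j).r (map p x) (map q x)
  /-- (F3) transports compose -/
  map_trans : ∀ {i j k : I} (p : i ≈ j) (q : j ≈ k) (x : obj i),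
    (std k).r (map q (map p x)) (map (Setoid.trans p q) x)

/-- The relation `~` on the setoid sum `Σ(I,F)`. -/
def SumRel {I : Type} [Setoid I] (F : PIFam I) :
    (Σ i, F.obj i) → (Σ i, F.obj i) → Prop :=
  fun u v => ∃ p : u.1 ≈ v.1, (F.std v.1).r (F.map p u.2) v.2

/-- The canonical injection `ι_i : F i → Σ(I,F)`. -/
def iota {I : Type} [Setoid I] (F : PIFam I) (i : I) (y : F.obj i) : Σ i, F.obj i :=
  ⟨i, y⟩

/-- The relation `~` on `Σ(I,F)` is an equivalence relation. -/
theorem sumRel_equivalence {I : Type} [Setoid I] (F : PIFam I) :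
    Equivalence (SumRel F) := by
  refine ⟨fun u => ⟨Setoid.refl u.1, F.map_refl u.1 u.2⟩, ?_, ?_⟩
  · rintro ⟨i, x⟩ ⟨j, y⟩ ⟨p, h⟩
    have q : j ≈ i := Setoid.symm p
    exact ⟨q, (F.std i).trans ((F.std i).symm (F.map_ext q h))
      ((F.std i).trans (F.map_trans p q x)
        ((F.std i).trans (F.map_irrel _ (Setoid.refl i) x) (F.map_refl i x)))⟩
  · rintro ⟨i, x⟩ ⟨j, y⟩ ⟨k, z⟩ ⟨p, h⟩ ⟨q, h'⟩
    exact ⟨Setoid.trans p q, (F.std k).trans ((F.std k).symm (F.map_trans p q x))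
      ((F.std k).trans (F.map_ext q h) h')⟩
end

section
/- Let F be a proof-irrelevant family of setoids over a setoid (I, ≈_I) and let (C, ≈_C) be a setoid. Suppose for each x : I an extensional function j_x : F x → C is given such that j_{x'}(F(p)(y)) ≈_C j_x(y) for all p : x ≈_I x' and all y : F x. Then there exists an extensional function k : Σ(I,F) → C with k(ι_x(y)) ≈_C j_x(y) for all x : I and y : F x, and any two extensional functions with this property are extensionally equal (universal property of the setoid sum). -/
/-- Universal property of the setoid sum `Σ(I,F)`: existence and uniqueness
(up to extensional equality) of the mediating extensional function. -/
theorem sum_universal_property {I C : Type} [Setoid I] [Setoid C] (F : PIFam I)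
    (j : ∀ x : I, F.obj x → C)
    (j_ext : ∀ (x : I) {y y' : F.obj x}, (F.std x).r y y' → j x y ≈ j x y')
    (j_compat : ∀ {x x' : I} (p : x ≈ x') (y : F.obj x), j x' (F.map p y) ≈ j x y) :
    (∃ k : (Σ i, F.obj i) → C,
      (∀ u v, SumRel F u v → k u ≈ k v) ∧ (∀ (x : I) (y : F.obj x), k (iota F x y) ≈ j x y)) ∧
    (∀ k k' : (Σ i, F.obj i) → C,
      (∀ u v, SumRel F u v → k u ≈ k v) → (∀ (x : I) (y : F.obj x), k (iota F x y) ≈ j x y) →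
      (∀ u v, SumRel F u v → k' u ≈ k' v) → (∀ (x : I) (y : F.obj x), k' (iota F x y) ≈ j x y) →
      ∀ u, k u ≈ k' u) := by
  refine ⟨⟨fun u => j u.1 u.2, ?_, fun x y => Setoid.refl _⟩, ?_⟩
  · rintro ⟨x, y⟩ ⟨x', y'⟩ ⟨p, h⟩
    exact Setoid.trans (Setoid.symm (j_compat p y)) (j_ext x' h)
  · rintro k k' - hk - hk' ⟨x, y⟩
    exact Setoid.trans (hk x y) (Setoid.symm (hk' x y))
end

section
/- Let C be an HF-category, D an E-category, and F : C → D an E-functor. For proofs p : a ≈ a' and q : b ≈ b' in the object setoid of C and f ∈ Hom_D(F a, F b), define S(p, q)(f) := F(Hom_C(r(b), q)(id_b)) ∘ f ∘ F(Hom_C(p, r(a))(id_a)). Then: (i) S(r(a), r(b))(f) ≈ f for all f ∈ Hom_D(F a, F b); and (ii) for p : a ≈ a', p' : a' ≈ a'', q : b ≈ b', q' : b' ≈ b'': S(p' ∘ p, q' ∘ q)(f) ≈ S(p', q')(S(p, q)(f)). (Hence the hom-setoids Hom_D(F a, F b) with these transports form a proof-irrelevant family indexed by pairs of objects of C.) 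-/
/-- A hom-family presented category (HF-category): a setoid of objects, a
proof-irrelevant family of hom-setoids with transports, identities and an
extensional composition, together with coherence conditions for the
transports. -/
structure HFCat where
  Ob : Type
  eqv : Ob → Ob → Prop
  eqvE : Equivalence eqv
  Hom : Ob → Ob → Type
  hrel : ∀ a b, Hom a b → Hom a b → Prop
  hrelE : ∀ a b, Equivalence (hrel a b)
  /-- transport `Hom(p, q) : Hom(a, b) → Hom(a', b')` -/
  tr : ∀ {a a' b b'}, eqv a a' → eqv b b' → Hom a b → Hom a' b'
  tr_ext : ∀ {a a' b b'} (p : eqv a a') (q : eqv b b') {f f' : Hom a b},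
    hrel a b f f' → hrel a' b' (tr p q f) (tr p q f')
  /-- (F1) transport along reflexivity is the identity -/
  tr_refl : ∀ {a b} (f : Hom a b), hrel a b (tr (eqvE.refl a) (eqvE.refl b) f) f
  /-- (F2) proof irrelevance of transport -/
  tr_irrel : ∀ {a a' b b'} (p p' : eqv a a') (q q' : eqv b b') (f : Hom a b),
    hrel a' b' (tr p q f) (tr p' q' f)
  /-- (F3) transports compose -/
  tr_trans : ∀ {a a' a'' b b' b''} (p : eqv a a') (p' : eqv a' a'')
    (q : eqv b b') (q' : eqv b' b'') (f : Hom a b),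
    hrel a'' b'' (tr p' q' (tr p q f)) (tr (eqvE.trans p p') (eqvE.trans q q') f)
  id : ∀ a, Hom a a
  comp : ∀ {a b c}, Hom b c → Hom a b → Hom a c
  comp_ext : ∀ {a b c} {g g' : Hom b c} {f f' : Hom a b},
    hrel b c g g' → hrel a b f f' → hrel a c (comp g f) (comp g' f')
  id_left : ∀ {a b} (f : Hom a b), hrel a b (comp (id b) f) f
  id_right : ∀ {a b} (f : Hom a b), hrel a b (comp f (id a)) f
  assoc : ∀ {a b c d} (f : Hom a b) (g : Hom b c) (h : Hom c d),
    hrel a d (comp h (comp g f)) (comp (comp h g) f)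
  /-- coherence of identities with transport -/
  coh_id : ∀ {a a'} (p : eqv a a'), hrel a' a' (id a') (tr p p (id a))
  /-- coherence of composition with transport -/
  coh_comp : ∀ {a a' b b' c c'} (p : eqv a a') (q : eqv b b') (r : eqv c c')
    (f : Hom a b) (g : Hom b c),
    hrel a' c' (comp (tr q r g) (tr p q f)) (tr p r (comp g f))

/-- An E-category: a type of objects, hom-setoids, identities and an
extensional composition satisfying unit and associativity laws. -/
structure ECat where
  Ob : Type
  Hom : Ob → Ob → Type
  hrel : ∀ a b, Hom a b → Hom a b → Prop
  hrelE : ∀ a b, Equivalence (hrel a b)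
  id : ∀ a, Hom a a
  comp : ∀ {a b c}, Hom b c → Hom a b → Hom a c
  comp_ext : ∀ {a b c} {g g' : Hom b c} {f f' : Hom a b},
    hrel b c g g' → hrel a b f f' → hrel a c (comp g f) (comp g' f')
  id_left : ∀ {a b} (f : Hom a b), hrel a b (comp (id b) f) f
  id_right : ∀ {a b} (f : Hom a b), hrel a b (comp f (id a)) f
  assoc : ∀ {a b c d} (f : Hom a b) (g : Hom b c) (h : Hom c d),
    hrel a d (comp h (comp g f)) (comp (comp h g) f)

/-- An E-functor from an HF-category `C` to an E-category `D`. -/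
structure EFunctor (C : HFCat) (D : ECat) where
  obj : C.Ob → D.Ob
  map : ∀ {a b}, C.Hom a b → D.Hom (obj a) (obj b)
  map_ext : ∀ {a b} {f f' : C.Hom a b}, C.hrel a b f f' →
    D.hrel (obj a) (obj b) (map f) (map f')
  map_id : ∀ a, D.hrel (obj a) (obj a) (map (C.id a)) (D.id (obj a))
  map_comp : ∀ {a b c} (g : C.Hom b c) (f : C.Hom a b),
    D.hrel (obj a) (obj c) (map (C.comp g f)) (D.comp (map g) (map f))

/-- The induced transport `S(p, q)` on the hom-setoids `Hom_D(F a, F b)` of the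
full image: `S(p, q)(f) = F(Hom_C(r(b), q)(id_b)) ∘ f ∘ F(Hom_C(p, r(a))(id_a))`. -/
def Str {C : HFCat} {D : ECat} (F : EFunctor C D) {a a' b b' : C.Ob}
    (p : C.eqv a a') (q : C.eqv b b') (f : D.Hom (F.obj a) (F.obj b)) :
    D.Hom (F.obj a') (F.obj b') :=
  D.comp (F.map (C.tr (C.eqvE.refl b) q (C.id b)))
    (D.comp f (F.map (C.tr p (C.eqvE.refl a) (C.id a))))

/-- Transported identities do not depend on which representative of the
equivalence class of objects the identity is taken at. -/
theorem HFCat.tr_id_rebase (C : HFCat) {a a' b c : C.Ob} (p : C.eqv a a')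
    (q : C.eqv a' b) (r : C.eqv a' c) :
    C.hrel b c (C.tr q r (C.id a'))
      (C.tr (C.eqvE.trans p q) (C.eqvE.trans p r) (C.id a)) :=
  (C.hrelE _ _).trans (C.tr_ext q r (C.coh_id p)) (C.tr_trans p q p r _)

/-- Transported identities are closed under composition. -/
theorem HFCat.comp_tr_id (C : HFCat) {a b c d : C.Ob} (p : C.eqv a b)
    (q : C.eqv a c) (r : C.eqv a d) :
    C.hrel b d (C.comp (C.tr q r (C.id a)) (C.tr p q (C.id a))) (C.tr p r (C.id a)) :=
  (C.hrelE _ _).trans (C.coh_comp p q r _ _) (C.tr_ext p r (C.id_left _))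

theorem HFCat.tr_id_trans_right (C : HFCat) {b b' b'' : C.Ob} (q : C.eqv b b')
    (q' : C.eqv b' b'') :
    C.hrel b b'' (C.tr (C.eqvE.refl b) (C.eqvE.trans q q') (C.id b))
      (C.comp (C.tr (C.eqvE.refl b') q' (C.id b')) (C.tr (C.eqvE.refl b) q (C.id b))) :=
  (C.hrelE _ _).symm <| (C.hrelE _ _).trans
    (C.comp_ext (C.tr_id_rebase q (C.eqvE.refl b') q') ((C.hrelE _ _).refl _))
    (C.comp_tr_id _ _ _)

theorem HFCat.tr_id_trans_left (C : HFCat) {a a' a'' : C.Ob} (p : C.eqv a a')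
    (p' : C.eqv a' a'') :
    C.hrel a'' a (C.tr (C.eqvE.trans p p') (C.eqvE.refl a) (C.id a))
      (C.comp (C.tr p (C.eqvE.refl a) (C.id a)) (C.tr p' (C.eqvE.refl a') (C.id a'))) :=
  (C.hrelE _ _).symm <| (C.hrelE _ _).trans
    (C.comp_ext ((C.hrelE _ _).refl _) (C.tr_id_rebase p p' (C.eqvE.refl a')))
    (C.comp_tr_id _ _ _)

theorem ECat.comp_comp_comp (D : ECat) {a b c d e k : D.Ob} (s : D.Hom a b)
    (t : D.Hom b c) (f : D.Hom c d) (u : D.Hom d e) (v : D.Hom e k) :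
    D.hrel a k (D.comp (D.comp v u) (D.comp f (D.comp t s)))
      (D.comp v (D.comp (D.comp u (D.comp f t)) s)) := by
  refine (D.hrelE _ _).trans ((D.hrelE _ _).symm (D.assoc _ _ _)) ?_
  refine D.comp_ext ((D.hrelE _ _).refl _) ?_
  refine (D.hrelE _ _).trans ?_ (D.assoc _ _ _)
  exact D.comp_ext ((D.hrelE _ _).refl _) (D.assoc _ _ _)

theorem EFunctor.map_tr_refl_id {C : HFCat} {D : ECat} (F : EFunctor C D) (a : C.Ob) :
    D.hrel (F.obj a) (F.obj a)
      (F.map (C.tr (C.eqvE.refl a) (C.eqvE.refl a) (C.id a))) (D.id (F.obj a)) :=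
  (D.hrelE _ _).trans (F.map_ext (C.tr_refl _)) (F.map_id a)

theorem EFunctor.map_hrel_comp {C : HFCat} {D : ECat} (F : EFunctor C D) {a b c : C.Ob}
    {h : C.Hom a c} {g : C.Hom b c} {f : C.Hom a b} (e : C.hrel a c h (C.comp g f)) :
    D.hrel (F.obj a) (F.obj c) (F.map h) (D.comp (F.map g) (F.map f)) :=
  (D.hrelE _ _).trans (F.map_ext e) (F.map_comp g f)

/-- The transports `S(p, q)` on the hom-setoids `Hom_D(F a, F b)` satisfy
(i) `S(r(a), r(b))(f) ≈ f` and (ii) `S(p' ∘ p, q' ∘ q)(f) ≈ S(p', q')(S(p, q)(f))`,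
so they form a proof-irrelevant family indexed by pairs of objects of `C`. -/
theorem fullImage_transport_family (C : HFCat) (D : ECat) (F : EFunctor C D) :
    (∀ {a b : C.Ob} (f : D.Hom (F.obj a) (F.obj b)),
      D.hrel (F.obj a) (F.obj b) (Str F (C.eqvE.refl a) (C.eqvE.refl b) f) f) ∧
    (∀ {a a' a'' b b' b'' : C.Ob} (p : C.eqv a a') (p' : C.eqv a' a'')
      (q : C.eqv b b') (q' : C.eqv b' b'') (f : D.Hom (F.obj a) (F.obj b)),
      D.hrel (F.obj a'') (F.obj b'')
        (Str F (C.eqvE.trans p p') (C.eqvE.trans q q') f)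
        (Str F p' q' (Str F p q f))) := by
  refine ⟨fun {a b} f => ?_, fun p p' q q' f => ?_⟩
  · refine (D.hrelE _ _).trans (D.comp_ext (F.map_tr_refl_id b)
      (D.comp_ext ((D.hrelE _ _).refl f) (F.map_tr_refl_id a))) ?_
    exact (D.hrelE _ _).trans (D.id_left _) (D.id_right f)
  · refine (D.hrelE _ _).trans
      (D.comp_ext (F.map_hrel_comp (C.tr_id_trans_right q q'))
        (D.comp_ext ((D.hrelE _ _).refl f) (F.map_hrel_comp (C.tr_id_trans_left p p')))) ?_
    exact D.comp_comp_comp _ _ _ _ _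
end
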